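/- For ω ∈ F_n let N_odd(ω) be the number of odd a ∈ {1, …, n−1} with b̃_{a-1} = 1 and b̃_a = 1, and let N_even(ω) be the number of even a ∈ {1, …, n−1} with b̃_{a-1} = 1 and b̃_a = 1. Then for every ε > 0, the conditional probability given F_n that both (1/9 − ε)·n < N_odd < (1/9 + ε)·n and (1/9 − ε)·n < N_even < (1/9 + ε)·n tends to 1 as n → ∞. -/

import Mathlib

open MeasureTheory ProbabilityTheory Filter

/-- `μ` is the infinite product over `ℕ` of the uniform probability measure on
`{-1,0,1} ⊆ ℤ`, characterized by its values on cylinder sets.  (Taking `n = 0`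
shows `μ` is a probability measure.) -/
def IsCDGProductMeasure (μ : Measure (ℕ → ℤ)) : Prop :=
  ∀ (n : ℕ) (c : ℕ → ℤ),
    μ {ω : ℕ → ℤ | ∀ i < n, ω i = c i} =
      ∏ i ∈ Finset.range n,
        (if c i = -1 ∨ c i = 0 ∨ c i = 1 then (1 / 3 : ENNReal) else 0)

/-- `S n b = ∑_{i=0}^{n-1} 2^(n-1-i) b i`. -/
def cdgS (n : ℕ) (b : ℕ → ℤ) : ℤ := ∑ i ∈ Finset.range n, 2 ^ (n - 1 - i) * b i

/-- The standard form `b̃ a` of the sequence `b` for length `n`: the binary digit of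
`S = ∑_{i<n} 2^(n-1-i) b i` in position `n-1-a`, so that (in the "first 1" case, where
`1 ≤ S ≤ 2^n − 1`) one has `S = ∑_{a<n} 2^(n-1-a) b̃ a` with each `b̃ a ∈ {0,1}`. -/
def btilde (n : ℕ) (b : ℕ → ℤ) (a : ℕ) : ℕ := (cdgS n b).toNat / 2 ^ (n - 1 - a) % 2

/-- The "first 1" event `F_n` for length `n`: there is `j < n` with `b j = 1` and
`b k = 0` for all `k < j`. -/
def firstOne (n : ℕ) : Set (ℕ → ℤ) :=
  {b : ℕ → ℤ | ∃ j < n, b j = 1 ∧ ∀ k < j, b k = 0}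

namespace CDG

def sh (ω : ℕ → ℤ) : ℕ → ℤ := fun i => ω (i + 1)

theorem cdgS_succ (n : ℕ) (ω : ℕ → ℤ) : cdgS (n + 1) ω = 2 ^ n * ω 0 + cdgS n (sh ω) := by
  unfold cdgS sh
  rw [Finset.sum_range_succ']
  rw [add_comm]
  congr 1
  apply Finset.sum_congr rfl
  intro i hi
  congr 2
  omega

theorem cdgS_congr (n : ℕ) (ω ω' : ℕ → ℤ) (h : ∀ i < n, ω i = ω' i) : cdgS n ω = cdgS n ω' := by
  unfold cdgS
  apply Finset.sum_congr rfl
  intro i hi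
  rw [h i (Finset.mem_range.1 hi)]

def rng (n : ℕ) (ω : ℕ → ℤ) : Prop := ∀ i < n, ω i = -1 ∨ ω i = 0 ∨ ω i = 1

theorem rng_sh {n : ℕ} {ω : ℕ → ℤ} (h : rng (n + 1) ω) : rng n (sh ω) :=
  fun i hi => h (i + 1) (by omega)

theorem cdgS_bd (n : ℕ) : ∀ (ω : ℕ → ℤ), rng n ω → - 2 ^ n < cdgS n ω ∧ cdgS n ω < 2 ^ n := by
  induction n with
  | zero => intro ω _; simp [cdgS]
  | succ n ih =>
    intro ω h
    have := ih (sh ω) (rng_sh h)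
    rw [cdgS_succ, pow_succ]
    rcases h 0 (by omega) with h0 | h0 | h0 <;> rw [h0] <;> constructor <;> linarith [this.1, this.2]

theorem cdgS_nonneg (n : ℕ) : ∀ (ω : ℕ → ℤ), rng n ω → ω ∈ firstOne n → 0 ≤ cdgS n ω := by
  induction n with
  | zero => intro ω _; simp [cdgS]
  | succ n ih =>
    rintro ω h ⟨j, hj, hj1, hj2⟩
    rw [cdgS_succ]
    rcases j with _ | j
    · rw [hj1]; linarith [(cdgS_bd n _ (rng_sh h)).1]
    · rw [hj2 0 (by omega)]
      have := ih (sh ω) (rng_sh h) ⟨j, by omega, hj1, fun k hk => hj2 (k + 1) (by omega)⟩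
      linarith

/-- floor quotient -/
def Q (n : ℕ) (ω : ℕ → ℤ) : ℤ := cdgS n ω / 2 ^ n

def dg (n : ℕ) (ω : ℕ → ℤ) (t : ℕ) : ℤ := cdgS n ω / 2 ^ t % 2

def D (n : ℕ) (ω : ℕ → ℤ) : ℤ := if n = 0 then 0 else dg n ω (n - 1)

theorem Q_vals (n : ℕ) (ω : ℕ → ℤ) (h : rng n ω) : Q n ω = -1 ∨ Q n ω = 0 := by
  have hb := cdgS_bd n ω h
  have hp : (0 : ℤ) < 2 ^ n := by positivity
  have h1 : -1 ≤ Q n ω := by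
    unfold Q; rw [Int.le_ediv_iff_mul_le hp]; linarith
  have h2 : Q n ω < 1 := by
    unfold Q; rw [Int.ediv_lt_iff_lt_mul hp]; linarith
  omega

theorem dg_vals (n : ℕ) (ω : ℕ → ℤ) (t : ℕ) : dg n ω t = 0 ∨ dg n ω t = 1 := by
  unfold dg; omega

theorem D_vals (n : ℕ) (ω : ℕ → ℤ) : D n ω = 0 ∨ D n ω = 1 := by
  unfold D; split_ifs
  · simp
  · exact dg_vals _ _ _

theorem top_succ (n : ℕ) (ω : ℕ → ℤ) : cdgS (n + 1) ω / 2 ^ n = ω 0 + Q n (sh ω) := by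
  have hp : (2 : ℤ) ^ n ≠ 0 := by positivity
  rw [cdgS_succ, Int.add_comm, Int.add_mul_ediv_left _ _ hp, Q, add_comm]

theorem Q_succ (n : ℕ) (ω : ℕ → ℤ) : Q (n + 1) ω = (ω 0 + Q n (sh ω)) / 2 := by
  rw [← top_succ, Q, pow_succ, Int.ediv_ediv_of_nonneg (by positivity)]

theorem D_succ (n : ℕ) (ω : ℕ → ℤ) : D (n + 1) ω = (ω 0 + Q n (sh ω)) % 2 := by
  simp [D, dg, top_succ]

theorem dg_succ (n : ℕ) (ω : ℕ → ℤ) (t : ℕ) (ht : t < n) : dg (n + 1) ω t = dg n (sh ω) t := by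
  have hp : (2 : ℤ) ^ t ≠ 0 := by positivity
  obtain ⟨k, rfl⟩ := Nat.exists_eq_add_of_lt ht
  unfold dg
  rw [cdgS_succ, Int.add_comm]
  have : (2 : ℤ) ^ (t + k + 1) * ω 0 = 2 ^ t * (2 * (2 ^ k * ω 0)) := by ring
  rw [this, Int.add_mul_ediv_left _ _ hp]
  omega

noncomputable def w (p t : ℕ) : ℝ := if t % 2 = p then 1 else 0

theorem w_cases (p t : ℕ) (hp : p = 0 ∨ p = 1) :
    (w p t = 0 ∧ w p (t + 1) = 1) ∨ (w p t = 1 ∧ w p (t + 1) = 0) := by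
  unfold w
  rcases Nat.mod_two_eq_zero_or_one t with h | h <;> rcases hp with rfl | rfl <;>
    simp [h, Nat.add_mod]

noncomputable def X (p n : ℕ) (ω : ℕ → ℤ) : ℝ :=
  ∑ t ∈ Finset.Ico 1 n, w p t * ((dg n ω (t - 1) : ℝ) * (dg n ω t : ℝ))

theorem X_succ (p n : ℕ) (ω : ℕ → ℤ) :
    X p (n + 1) ω = X p n (sh ω) + w p n * ((D n (sh ω) : ℝ) * (D (n + 1) ω : ℝ)) := by
  rcases Nat.eq_zero_or_pos n with rfl | hn
  · simp [X, D]
  · unfold X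
    rw [Finset.sum_Ico_succ_top hn]
    congr 1
    · apply Finset.sum_congr rfl
      intro t ht
      have := Finset.mem_Ico.1 ht
      rw [dg_succ _ _ _ (by omega), dg_succ _ _ _ (by omega)]
    · rw [dg_succ _ _ _ (by omega)]
      simp [D, hn.ne']

noncomputable def H (v q d : ℝ) : ℝ := v * d * (2 + q) / 3 - v / 9 + (2 / 9) * (9 / 8 - 3 / 4 * v) * (q + 1 / 2)

noncomputable def M (p n : ℕ) (ω : ℕ → ℤ) : ℝ := X p n ω - n / 9 + H (w p n) (Q n ω) (D n ω)

theorem M_close (p n : ℕ) (hp : p = 0 ∨ p = 1) (ω : ℕ → ℤ) (h : rng n ω) :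
    |X p n ω - n / 9| ≤ |M p n ω| + 1 := by
  have : |H (w p n) (Q n ω) (D n ω)| ≤ 1 := by
    unfold H
    rcases w_cases p n hp with ⟨h1, -⟩ | ⟨h1, -⟩ <;> rcases Q_vals n ω h with h2 | h2 <;>
      rcases D_vals n ω with h3 | h3 <;> rw [h1, h2, h3, abs_le] <;> norm_num
  have e : X p n ω - n / 9 = M p n ω - H (w p n) (Q n ω) (D n ω) := by unfold M; ring
  rw [e]
  exact (abs_sub _ _).trans (by linarith)

/-- extension of a finite word -/
def ex {n : ℕ} (u : Fin n → Fin 3) : ℕ → ℤ :=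
  fun i => if h : i < n then ((u ⟨i, h⟩ : ℕ) : ℤ) - 1 else 0

theorem rng_ex {n : ℕ} (u : Fin n → Fin 3) : rng n (ex u) := by
  intro i hi
  have := (u ⟨i, hi⟩).2
  simp only [ex, hi, dif_pos]
  omega

theorem ex_cons_zero {n : ℕ} (b : Fin 3) (u : Fin n → Fin 3) :
    ex (Fin.cons b u : Fin (n + 1) → Fin 3) 0 = ((b : ℕ) : ℤ) - 1 := by
  simp [ex]

theorem sh_ex_cons {n : ℕ} (b : Fin 3) (u : Fin n → Fin 3) :
    sh (ex (Fin.cons b u : Fin (n + 1) → Fin 3)) = ex u := by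
  funext i
  simp only [sh, ex]
  by_cases h : i < n
  · rw [dif_pos h, dif_pos (by omega)]
    rfl
  · rw [dif_neg h, dif_neg (by omega)]

theorem step_sq (p n : ℕ) (hp : p = 0 ∨ p = 1) (u : Fin n → Fin 3) :
    ∑ b : Fin 3, (M p (n + 1) (ex (Fin.cons b u : Fin (n + 1) → Fin 3))) ^ 2
      ≤ 3 * ((M p n (ex u)) ^ 2 + 9) := by
  have key : ∀ b : Fin 3, M p (n + 1) (ex (Fin.cons b u : Fin (n + 1) → Fin 3)) =
      M p n (ex u) - H (w p n) (Q n (ex u)) (D n (ex u)) - 1 / 9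
      + w p n * ((D n (ex u) : ℝ) * ((((((b : ℕ) : ℤ) - 1 + Q n (ex u)) % 2 : ℤ)) : ℝ))
      + H (w p (n + 1)) ((((((b : ℕ) : ℤ) - 1 + Q n (ex u)) / 2 : ℤ)) : ℝ)
        ((((((b : ℕ) : ℤ) - 1 + Q n (ex u)) % 2 : ℤ)) : ℝ) := by
    intro b
    unfold M
    rw [X_succ, D_succ, Q_succ, sh_ex_cons, ex_cons_zero]
    push_cast
    ring
  simp only [key]
  generalize M p n (ex u) = m
  rw [Fin.sum_univ_three]
  unfold H
  rcases w_cases p n hp with ⟨h1, h1'⟩ | ⟨h1, h1'⟩ <;>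
    rcases Q_vals n (ex u) (rng_ex u) with h2 | h2 <;>
    rcases D_vals n (ex u) with h3 | h3 <;> rw [h1, h1', h2, h3] <;> norm_num <;> nlinarith

theorem second_moment (p : ℕ) (hp : p = 0 ∨ p = 1) (n : ℕ) :
    ∑ u : Fin n → Fin 3, (M p n (ex u)) ^ 2 ≤ 3 ^ n * (9 * n + 1) := by
  induction n with
  | zero =>
    rw [Fintype.sum_unique]
    unfold M X H
    rcases w_cases p 0 hp with ⟨h1, -⟩ | ⟨h1, -⟩ <;> rw [h1] <;> norm_num [Q, D, cdgS]
  | succ n ih =>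
    rw [← (Fin.consEquiv (fun _ : Fin (n + 1) => Fin 3)).sum_comp, Fintype.sum_prod_type,
      Finset.sum_comm]
    calc _ ≤ ∑ u : Fin n → Fin 3, 3 * ((M p n (ex u)) ^ 2 + 9) :=
          Finset.sum_le_sum fun u _ => step_sq p n hp u
      _ = 3 * (∑ u : Fin n → Fin 3, (M p n (ex u)) ^ 2) + 3 * (3 ^ n * 9) := by
          rw [← Finset.mul_sum, Finset.sum_add_distrib]
          simp
          ring
      _ ≤ 3 * (3 ^ n * (9 * n + 1)) + 3 * (3 ^ n * 9) := by linarith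
      _ = _ := by push_cast; ring

open Classical in
noncomputable def bad (p n : ℕ) (ε : ℝ) : Finset (Fin n → Fin 3) :=
  Finset.univ.filter fun u => ε * n ≤ |X p n (ex u) - n / 9|

theorem bad_card (p : ℕ) (hp : p = 0 ∨ p = 1) (n : ℕ) (ε : ℝ) (hε : 0 < ε) (hn : 2 ≤ ε * n) :
    ((bad p n ε).card : ℝ) * (ε * n / 2) ^ 2 ≤ 3 ^ n * (9 * n + 1) := by
  refine le_trans ?_ (second_moment p hp n)
  rw [← nsmul_eq_mul]
  refine (Finset.card_nsmul_le_sum (bad p n ε) (fun u => (M p n (ex u)) ^ 2) _ ?_).trans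
    (Finset.sum_le_sum_of_subset_of_nonneg (Finset.subset_univ _) fun _ _ _ => sq_nonneg _)
  intro u hu
  have h1 : ε * n ≤ |X p n (ex u) - n / 9| := by simpa [bad] using hu
  have h2 := M_close p n hp (ex u) (rng_ex u)
  rw [← sq_abs (M p n (ex u))]
  apply pow_le_pow_left₀ (by linarith)
  linarith

theorem X_congr (p n : ℕ) (ω ω' : ℕ → ℤ) (h : ∀ i < n, ω i = ω' i) : X p n ω = X p n ω' := by
  unfold X dg
  rw [cdgS_congr n ω ω' h]

theorem btilde_iff (n : ℕ) (ω : ℕ → ℤ) (h : 0 ≤ cdgS n ω) (a : ℕ) :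
    btilde n ω a = 1 ↔ dg n ω (n - 1 - a) = 1 := by
  unfold btilde dg
  obtain ⟨k, hk⟩ := Int.eq_ofNat_of_zero_le h
  rw [hk]
  simp only [Int.toNat_natCast]
  norm_cast

theorem card_eq (p n : ℕ) (ω : ℕ → ℤ) (h : 0 ≤ cdgS n ω) (P : ℕ → Prop) [DecidablePred P]
    (hP : ∀ a < n, P a ↔ (n - a) % 2 = p) :
    (((Finset.Ico 1 n).filter (fun a =>
            P a ∧ btilde n ω (a - 1) = 1 ∧ btilde n ω a = 1)).card : ℝ) = X p n ω := by
  rw [Finset.card_filter]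
  push_cast
  unfold X
  refine Finset.sum_nbij' (fun a => n - a) (fun a => n - a) ?_ ?_ ?_ ?_ ?_
  · intro a ha; simp at ha ⊢; omega
  · intro a ha; simp at ha ⊢; omega
  · intro a ha; simp at ha ⊢; omega
  · intro a ha; simp at ha ⊢; omega
  · intro a ha
    simp only [Finset.mem_Ico] at ha
    simp only [btilde_iff n ω h, hP a ha.2]
    rw [show n - 1 - (a - 1) = n - a by omega, show n - 1 - a = n - a - 1 by omega]
    unfold w
    by_cases h0 : (n - a) % 2 = p <;> rcases dg_vals n ω (n - a) with h1 | h1 <;>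
      rcases dg_vals n ω (n - a - 1) with h2 | h2 <;> simp [h0, h1, h2]

theorem cyl (μ : Measure (ℕ → ℤ)) (hμ : IsCDGProductMeasure μ) (n : ℕ) (u : Fin n → Fin 3) :
    μ {ω | ∀ i < n, ω i = ex u i} = (1 / 3 : ENNReal) ^ n := by
  rw [hμ n (ex u), Finset.prod_congr rfl (g := fun _ => (1 / 3 : ENNReal))]
  · simp
  · intro i hi
    rw [if_pos (rng_ex u i (Finset.mem_range.1 hi))]

theorem not_rng_null (μ : Measure (ℕ → ℤ)) (hμ : IsCDGProductMeasure μ) (n : ℕ) :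
    μ {ω | ¬ rng n ω} = 0 := by
  let e : (Fin n → ℤ) → ℕ → ℤ := fun u i => if h : i < n then u ⟨i, h⟩ else 0
  refine measure_mono_null (t := ⋃ u : {u : Fin n → ℤ // ¬ rng n (e u)},
    {ω | ∀ i < n, ω i = e u.1 i}) ?_ ?_
  · intro ω hω
    have h : ∀ i < n, ω i = e (fun i => ω i) i := by
      intro i hi; simp [e, hi]
    refine Set.mem_iUnion.2 ⟨⟨fun i => ω i, ?_⟩, h⟩
    intro hr
    apply hω
    intro i hi
    rw [h i hi]
    exact hr i hi
  · rw [measure_iUnion_null_iff]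
    rintro ⟨u, hu⟩
    rw [hμ n (e u)]
    unfold rng at hu
    push Not at hu
    obtain ⟨i, hi, h1, h2, h3⟩ := hu
    apply Finset.prod_eq_zero (Finset.mem_range.2 hi)
    simp [h1, h2, h3]

theorem third_le (μ : Measure (ℕ → ℤ)) (hμ : IsCDGProductMeasure μ) (n : ℕ) (hn : 0 < n) :
    (1 / 3 : ENNReal) ≤ μ (firstOne n) := by
  have := hμ 1 (fun _ => 1)
  simp only [Finset.prod_range_one] at this
  rw [if_pos (by norm_num)] at this
  rw [← this]
  apply measure_mono
  intro ω h
  exact ⟨0, hn, h 0 (by norm_num), by simp⟩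

theorem meas_firstOne (n : ℕ) : MeasurableSet (firstOne n) := by
  have : firstOne n = ⋃ j : ℕ, ⋃ _ : j < n,
      ((fun ω : ℕ → ℤ => ω j) ⁻¹' {1} ∩ ⋂ k : ℕ, ⋂ _ : k < j, (fun ω : ℕ → ℤ => ω k) ⁻¹' {0}) := by
    ext ω; simp [firstOne, and_left_comm]
  rw [this]
  refine MeasurableSet.iUnion fun j => MeasurableSet.iUnion fun _ => MeasurableSet.inter ?_ ?_
  · exact measurable_pi_apply j (measurableSet_singleton _)
  · exact MeasurableSet.iInter fun k => MeasurableSet.iInter fun _ =>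
      measurable_pi_apply k (measurableSet_singleton _)

theorem main_bound (μ : Measure (ℕ → ℤ)) (hμ : IsCDGProductMeasure μ) (ε : ℝ) (hε : 0 < ε)
    (n : ℕ) (hn0 : 0 < n) (hn : 2 ≤ ε * n) (G : Set (ℕ → ℤ))
    (hG : ∀ ω ∈ firstOne n, rng n ω → (∀ p, p = 0 ∨ p = 1 → |X p n ω - n / 9| < ε * n) → ω ∈ G) :
    μ[|firstOne n] Gᶜ ≤ ENNReal.ofReal (240 / (ε ^ 2 * n)) := by
  have hn1 : (1 : ℝ) ≤ n := by exact_mod_cast hn0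
  rw [cond_apply (meas_firstOne n)]
  have sub : firstOne n ∩ Gᶜ ⊆ {ω | ¬ rng n ω} ∪
      ((⋃ u ∈ bad 0 n ε, {ω | ∀ i < n, ω i = ex u i}) ∪
       (⋃ u ∈ bad 1 n ε, {ω | ∀ i < n, ω i = ex u i})) := by
    rintro ω ⟨hF, hω⟩
    by_cases hr : rng n ω
    swap
    · exact Or.inl hr
    right
    have : ∃ p, (p = 0 ∨ p = 1) ∧ ε * n ≤ |X p n ω - n / 9| := by
      by_contra! hc
      exact hω (hG ω hF hr hc)
    obtain ⟨p, hp, hb⟩ := this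
    let u : Fin n → Fin 3 := fun i => ⟨(ω i + 1).toNat, by
      have := hr i i.2
      omega⟩
    have hu : ∀ i < n, ω i = ex u i := by
      intro i hi
      have := hr i hi
      simp only [ex, hi, dif_pos, u]
      omega
    have hub : u ∈ bad p n ε := by
      simp only [bad, Finset.mem_filter, Finset.mem_univ, true_and]
      rwa [← X_congr p n ω _ hu]
    rcases hp with rfl | rfl
    · exact Or.inl (Set.mem_biUnion hub hu)
    · exact Or.inr (Set.mem_biUnion hub hu)
  have B : ∀ p, p = 0 ∨ p = 1 → μ (⋃ u ∈ bad p n ε, {ω | ∀ i < n, ω i = ex u i}) ≤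
      ENNReal.ofReal (40 / (ε ^ 2 * n)) := by
    intro p hp
    refine (measure_biUnion_finset_le _ _).trans ?_
    simp only [cyl μ hμ, Finset.sum_const]
    have : (bad p n ε).card • (1 / 3 : ENNReal) ^ n
        = ENNReal.ofReal ((bad p n ε).card * (1 / 3) ^ n) := by
      rw [ENNReal.ofReal_mul (by positivity), ENNReal.ofReal_pow (by norm_num),
        ENNReal.ofReal_div_of_pos (by norm_num)]
      simp
    rw [this]
    apply ENNReal.ofReal_le_ofReal
    have hc := bad_card p hp n ε hε hn
    rw [one_div, inv_pow, ← div_eq_mul_inv, div_le_div_iff₀ (by positivity) (by positivity)]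
    have h3 : (0 : ℝ) < 3 ^ n := by positivity
    have : ((bad p n ε).card : ℝ) * (ε ^ 2 * n) * n ≤ 40 * 3 ^ n * n := by
      have : (3 : ℝ) ^ n * 1 ≤ 3 ^ n * n := by gcongr
      nlinarith
    exact le_of_mul_le_mul_right this (by linarith)
  have hb : μ (firstOne n ∩ Gᶜ) ≤ ENNReal.ofReal (80 / (ε ^ 2 * n)) := by
    refine (measure_mono sub).trans ((measure_union_le _ _).trans ?_)
    rw [not_rng_null μ hμ, zero_add]
    refine (measure_union_le _ _).trans ((add_le_add (B 0 (by simp)) (B 1 (by simp))).trans ?_)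
    rw [← ENNReal.ofReal_add (by positivity) (by positivity)]
    apply ENNReal.ofReal_le_ofReal
    rw [← add_div]; norm_num
  have hi : (μ (firstOne n))⁻¹ ≤ ENNReal.ofReal 3 := by
    rw [ENNReal.inv_le_iff_inv_le]
    refine le_trans ?_ (third_le μ hμ n hn0)
    simp
  refine (mul_le_mul' hi hb).trans ?_
  rw [← ENNReal.ofReal_mul (by norm_num)]
  apply ENNReal.ofReal_le_ofReal
  rw [← mul_div_assoc]; norm_num

theorem main_bound2 (μ : Measure (ℕ → ℤ)) (hμ : IsCDGProductMeasure μ) (ε : ℝ) (hε : 0 < ε)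
    (n : ℕ) (hn0 : 0 < n) (hn : 2 ≤ ε * n) [IsProbabilityMeasure μ[|firstOne n]]
    (G : Set (ℕ → ℤ))
    (hG : ∀ ω ∈ firstOne n, rng n ω → (∀ p, p = 0 ∨ p = 1 → |X p n ω - n / 9| < ε * n) → ω ∈ G) :
    1 ≤ μ[|firstOne n] G + ENNReal.ofReal (240 / (ε ^ 2 * n)) := by
  refine le_trans ?_ (add_le_add le_rfl (main_bound μ hμ ε hε n hn0 hn G hG))
  rw [← measure_univ (μ := μ[|firstOne n]), ← Set.union_compl_self G]
  exact measure_union_le _ _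

end CDG

/-- with `N_odd(ω)` (resp. `N_even(ω)`) the number of odd (resp. even)
`a ∈ {1,…,n−1}` with `b̃_{a-1} = 1` and `b̃_a = 1`, for every `ε > 0` the conditional
probability given `F_n` that both `(1/9 − ε)n < N_odd < (1/9 + ε)n` and
`(1/9 − ε)n < N_even < (1/9 + ε)n` tends to `1` as `n → ∞`. -/
theorem stmt_13 (μ : Measure (ℕ → ℤ)) (hμ : IsCDGProductMeasure μ) (ε : ℝ) (hε : 0 < ε) :
    Tendsto (fun n : ℕ =>
      μ[|firstOne n] {ω : ℕ → ℤ |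
        ((1 / 9 - ε) * n <
          (((Finset.Ico 1 n).filter (fun a =>
            Odd a ∧ btilde n ω (a - 1) = 1 ∧ btilde n ω a = 1)).card : ℝ) ∧
        (((Finset.Ico 1 n).filter (fun a =>
            Odd a ∧ btilde n ω (a - 1) = 1 ∧ btilde n ω a = 1)).card : ℝ) <
          (1 / 9 + ε) * n) ∧
        ((1 / 9 - ε) * n <
          (((Finset.Ico 1 n).filter (fun a =>
            Even a ∧ btilde n ω (a - 1) = 1 ∧ btilde n ω a = 1)).card : ℝ) ∧
        (((Finset.Ico 1 n).filter (fun a =>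
            Even a ∧ btilde n ω (a - 1) = 1 ∧ btilde n ω a = 1)).card : ℝ) <
          (1 / 9 + ε) * n)})
      atTop (nhds 1) := by
  have hprob : IsProbabilityMeasure μ := ⟨by simpa using hμ 0 (fun _ => 0)⟩
  have hlim : Tendsto (fun n : ℕ => 1 - ENNReal.ofReal (240 / (ε ^ 2 * n))) atTop (nhds 1) := by
    have h1 : Tendsto (fun n : ℕ => 240 / (ε ^ 2 * (n : ℝ))) atTop (nhds 0) :=
      Tendsto.const_div_atTop
        (Tendsto.const_mul_atTop (by positivity) tendsto_natCast_atTop_atTop) _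
    have h2 := ENNReal.tendsto_ofReal h1
    have h3 := ENNReal.Tendsto.sub (tendsto_const_nhds (x := (1 : ENNReal))) h2 (by simp)
    simpa using h3
  have hev : ∀ᶠ n : ℕ in atTop, 0 < n ∧ 2 ≤ ε * n :=
    (eventually_gt_atTop 0).and
      ((Tendsto.const_mul_atTop hε tendsto_natCast_atTop_atTop).eventually_ge_atTop 2)
  refine tendsto_of_tendsto_of_tendsto_of_le_of_le' hlim tendsto_const_nhds ?_ ?_
  · filter_upwards [hev] with n hn
    have hF : μ (firstOne n) ≠ 0 := by
      have := CDG.third_le μ hμ n hn.1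
      intro h
      rw [h] at this
      simp at this
    have := cond_isProbabilityMeasure hF
    rw [tsub_le_iff_right]
    refine CDG.main_bound2 μ hμ ε hε n hn.1 hn.2 _ ?_
    · intro ω hω hr hX
      have h0 := CDG.cdgS_nonneg n ω hr hω
      have ho := CDG.card_eq ((n + 1) % 2) n ω h0 (fun a => Odd a)
        (fun a ha => by rw [Nat.odd_iff]; omega)
      have he := CDG.card_eq (n % 2) n ω h0 (fun a => Even a)
        (fun a ha => by rw [Nat.even_iff]; omega)
      have h1 := abs_lt.1 (hX ((n + 1) % 2) (by omega))
      have h2 := abs_lt.1 (hX (n % 2) (by omega))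
      simp only [Set.mem_setOf_eq]
      rw [ho, he]
      refine ⟨⟨?_, ?_⟩, ⟨?_, ?_⟩⟩ <;> linarith [h1.1, h1.2, h2.1, h2.2]
  · filter_upwards [hev] with n hn
    have hF : μ (firstOne n) ≠ 0 := by
      have := CDG.third_le μ hμ n hn.1
      intro h
      rw [h] at this
      simp at this
    have := cond_isProbabilityMeasure hF
    exact prob_le_one
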